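/- Let k be a positive rational number such that √k is irrational and let γ, γ' ∈ (0, 1/10). Then there exist positive constants C = C(k, γ, γ') and χ = χ(γ) such that for every N ∈ [1, ∞) and every ξ ∈ m₁(N; k, γ, γ'), one has | (1/N) ∑_{n=1}^{⌊N⌋} e(ξ n⌊n√k⌋) | ≤ C N^{−χ}. -/

import Mathlib

/-- `e(x) = exp(2πix)`. -/
noncomputable def expc (x : ℝ) : ℂ := Complex.exp (2 * Real.pi * Complex.I * x)

/-- `‖x‖ = min_{n ∈ ℤ} |x − n|`, the distance from `x` to the nearest integer. -/
noncomputable def distToInt (x : ℝ) : ℝ := |x - (round x : ℤ)|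

/-- Admissible indices `(a, b, q)` for the arcs at scale `N` with parameter `γ`:
`q ∈ {1,…,⌊N^γ⌋}`, `b ∈ ℤ` with `|b| ≤ N^γ`, `a ∈ {1,…,q}` and `gcd(a,b,q) = 1`. -/
def goodIdx (N γ : ℝ) (a b : ℤ) (q : ℕ) : Prop :=
  0 < q ∧ (q : ℝ) ≤ N ^ γ ∧ |(b : ℝ)| ≤ N ^ γ ∧ 1 ≤ a ∧ a ≤ (q : ℤ) ∧
    Int.gcd a (Int.gcd b (q : ℤ)) = 1

/-- The major arcs `M(N; k, γ, γ')`. -/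
noncomputable def majorArcs (k N γ γ' : ℝ) : Set ℝ :=
  {ξ | ξ ∈ Set.Ico (-(1 / 2) : ℝ) (1 / 2) ∧ ∃ (a b : ℤ) (q : ℕ), goodIdx N γ a b q ∧
    distToInt (ξ - ((a : ℝ) + (b : ℝ) * Real.sqrt k) / q) ≤ N ^ (-2 + γ')}

/-- The minor arcs `m(N; k, γ, γ') = [−1/2, 1/2) \ M(N; k, γ, γ')`. -/
noncomputable def minorArcs (k N γ γ' : ℝ) : Set ℝ :=
  Set.Ico (-(1 / 2) : ℝ) (1 / 2) \ majorArcs k N γ γ'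

/-- The exponential sum `(1/N) ∑_{n=1}^{⌊N⌋} e(ξ n⌊n√k⌋)`. -/
noncomputable def expSum (k N ξ : ℝ) : ℂ :=
  ((N : ℝ) : ℂ)⁻¹ * ∑ n ∈ Finset.Icc 1 (⌊N⌋).toNat,
      expc (ξ * ((n : ℝ) * (⌊(n : ℝ) * Real.sqrt k⌋ : ℝ)))

/-- The wide arcs `⋃ M̃_{a,b,q}` with radius `N^{−1+γ}`. -/
noncomputable def wideArcs (k N γ : ℝ) : Set ℝ :=
  {ξ | ξ ∈ Set.Ico (-(1 / 2) : ℝ) (1 / 2) ∧ ∃ (a b : ℤ) (q : ℕ), goodIdx N γ a b q ∧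
    distToInt (ξ - ((a : ℝ) + (b : ℝ) * Real.sqrt k) / q) ≤ N ^ (-1 + γ)}

/-- `m₂(N; k, γ, γ') = (⋃ M̃_{a,b,q}) \ M(N; k, γ, γ')`. -/
noncomputable def minor2 (k N γ γ' : ℝ) : Set ℝ :=
  wideArcs k N γ \ majorArcs k N γ γ'

/-- `m₁(N; k, γ, γ') = m(N; k, γ, γ') \ m₂(N; k, γ, γ')`. -/
noncomputable def minor1 (k N γ γ' : ℝ) : Set ℝ :=
  minorArcs k N γ γ' \ minor2 k N γ γ'

lemma expc_eq (x : ℝ) : expc x = Complex.exp (Complex.I * (2 * Real.pi * x : ℝ)) := by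
  unfold expc
  congr 1
  push_cast
  ring

lemma expc_add (x y : ℝ) : expc (x + y) = expc x * expc y := by
  simp only [expc, ← Complex.exp_add]
  congr 1
  push_cast
  ring

lemma norm_expc (x : ℝ) : ‖expc x‖ = 1 := by
  rw [expc_eq, mul_comm]
  exact Complex.norm_exp_ofReal_mul_I _

lemma expc_int (m : ℤ) : expc m = 1 := by
  unfold expc
  rw [Complex.exp_eq_one_iff]
  exact ⟨m, by push_cast; ring⟩

lemma expc_zero : expc 0 = 1 := by simpa using expc_int 0

lemma conj_expc (x : ℝ) : (starRingEnd ℂ) (expc x) = expc (-x) := by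
  unfold expc
  rw [← Complex.exp_conj]
  congr 1
  simp only [map_mul, Complex.conj_ofReal, Complex.conj_I, map_ofNat]
  push_cast
  ring

lemma expc_nat_mul (n : ℕ) (x : ℝ) : expc (n * x) = expc x ^ n := by
  unfold expc
  rw [← Complex.exp_nat_mul]
  congr 1
  push_cast
  ring

lemma expc_congr_int {x y : ℝ} (m : ℤ) (h : x = y + m) : expc x = expc y := by
  rw [h, expc_add, expc_int, mul_one]

lemma norm_expc_sub_one (x : ℝ) : ‖expc x - 1‖ = 2 * |Real.sin (Real.pi * x)| := by
  rw [expc_eq, Complex.norm_exp_I_mul_ofReal_sub_one, Real.norm_eq_abs, abs_mul, abs_two]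
  congr 3
  ring

lemma norm_expc_sub_one_le (x : ℝ) : ‖expc x - 1‖ ≤ 2 * Real.pi * |x| := by
  rw [norm_expc_sub_one]
  have := Real.abs_sin_le_abs (x := Real.pi * x)
  rw [abs_mul, abs_of_pos Real.pi_pos] at this
  linarith

lemma norm_expc_sub_expc_le (x y : ℝ) : ‖expc x - expc y‖ ≤ 2 * Real.pi * |x - y| := by
  have h : expc x - expc y = expc y * (expc (x - y) - 1) := by
    rw [mul_sub, ← expc_add]
    simp
  rw [h, norm_mul, norm_expc, one_mul]
  exact norm_expc_sub_one_le _

lemma four_mul_le_norm_expc_sub_one {x δ : ℝ} (h : ∀ m : ℤ, δ ≤ |x - m|) :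
    4 * δ ≤ ‖expc x - 1‖ := by
  have hx : expc x = expc (x - round x) := expc_congr_int (round x) (by ring)
  have h1 := h (round x)
  have h2 := abs_sub_round x
  rw [hx, norm_expc_sub_one]
  have h3 : |Real.pi * (x - round x)| ≤ Real.pi / 2 := by
    rw [abs_mul, abs_of_pos Real.pi_pos]
    nlinarith [Real.pi_pos]
  have h4 := Real.mul_abs_le_abs_sin h3
  rw [abs_mul, abs_of_pos Real.pi_pos] at h4
  have h5 : 2 / Real.pi * (Real.pi * |x - round x|) = 2 * |x - round x| := by
    field_simp
  linarith

/-- A geometric sum of additive characters is controlled by the distance of the frequency to `ℤ`. -/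
lemma norm_sum_expc_le {x δ : ℝ} (hδ : 0 < δ) (h : ∀ m : ℤ, δ ≤ |x - m|) (M : ℕ) :
    ‖∑ n ∈ Finset.range M, expc (n * x)‖ ≤ 1 / (2 * δ) := by
  have h4 := four_mul_le_norm_expc_sub_one h
  have hne : expc x ≠ 1 := by
    intro h0
    rw [h0] at h4
    simp at h4
    linarith
  simp only [expc_nat_mul]
  rw [geom_sum_eq hne, norm_div]
  have h2 : ‖expc x ^ M - 1‖ ≤ 2 := by
    refine (norm_sub_le _ _).trans ?_
    rw [norm_pow, norm_expc]
    norm_num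
  rw [div_le_div_iff₀ (by linarith) (by positivity)]
  nlinarith [norm_nonneg (expc x ^ M - 1)]

lemma sum_expc_sub_mul (J : ℕ) (t : ℝ) :
    ((‖∑ j ∈ Finset.range J, expc (j * t)‖ ^ 2 : ℝ) : ℂ) =
      ∑ j ∈ Finset.range J, ∑ l ∈ Finset.range J, expc (((j : ℝ) - l) * t) := by
  rw [Complex.ofReal_pow, ← Complex.mul_conj', map_sum, Finset.sum_mul_sum]
  refine Finset.sum_congr rfl fun j _ => Finset.sum_congr rfl fun l _ => ?_
  rw [conj_expc, ← expc_add]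
  congr 1
  ring

/-- Fejér weight attached to the node `i / J`. -/
noncomputable def fejerWeight (J i : ℕ) (x : ℝ) : ℝ :=
  ‖∑ j ∈ Finset.range J, expc (j * (x - i / J))‖ ^ 2 / J ^ 2

lemma fejerWeight_nonneg (J i : ℕ) (x : ℝ) : 0 ≤ fejerWeight J i x := by
  unfold fejerWeight
  positivity

lemma fejerWeight_le {J i : ℕ} {x τ : ℝ} (hτ : 0 < τ) (h : ∀ m : ℤ, τ ≤ |x - i / J - m|) :
    fejerWeight J i x ≤ 1 / (4 * J ^ 2 * τ ^ 2) := by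
  unfold fejerWeight
  have h1 := norm_sum_expc_le hτ h J
  have h2 : ‖∑ j ∈ Finset.range J, expc (j * (x - i / J))‖ ^ 2 ≤ (1 / (2 * τ)) ^ 2 := by
    gcongr
  calc _ ≤ (1 / (2 * τ)) ^ 2 / J ^ 2 := by gcongr
    _ = _ := by ring

lemma ofReal_fejerWeight (J i : ℕ) (x : ℝ) :
    (fejerWeight J i x : ℂ) = (1 / (J : ℂ) ^ 2) *
      ∑ j ∈ Finset.range J, ∑ l ∈ Finset.range J, expc (((j : ℝ) - l) * (x - i / J)) := by
  rw [← sum_expc_sub_mul]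
  unfold fejerWeight
  push_cast
  ring

lemma sum_expc_div {J j l : ℕ} (hj : j < J) (hl : l < J) :
    ∑ i ∈ Finset.range J, expc (i * (-((j : ℝ) - l) / J)) = if j = l then (J : ℂ) else 0 := by
  have hJ : (J : ℝ) ≠ 0 := by
    have : 0 < J := by omega
    positivity
  split_ifs with h
  · subst h
    simp [expc_zero]
  · have hne : expc (-((j : ℝ) - l) / J) ≠ 1 := by
      intro h1
      unfold expc at h1
      rw [Complex.exp_eq_one_iff] at h1
      obtain ⟨m, hm⟩ := h1
      have h2 : ((-((j : ℝ) - l) / J : ℝ) : ℂ) = ((m : ℝ) : ℂ) := by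
        have h3 : (2 * Real.pi * Complex.I : ℂ) ≠ 0 := Complex.two_pi_I_ne_zero
        apply mul_left_cancel₀ h3
        rw [hm]
        push_cast
        ring
      have h4 := Complex.ofReal_injective h2
      rw [div_eq_iff hJ] at h4
      have h5 : -((j : ℤ) - l) = m * J := by exact_mod_cast h4
      have h6 : (J : ℤ) ∣ (l : ℤ) - j := ⟨m, by linarith⟩
      have h7 := Int.eq_zero_of_abs_lt_dvd h6 (by rw [abs_lt]; constructor <;> omega)
      omega
    simp only [expc_nat_mul]
    rw [geom_sum_eq hne, ← expc_nat_mul]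
    have : expc ((J : ℝ) * (-((j : ℝ) - l) / J)) = 1 := by
      rw [mul_div_cancel₀ _ hJ]
      simpa using expc_int (-((j : ℤ) - l))
    rw [this]
    simp

lemma sum_fejerWeight {J : ℕ} (hJ : 0 < J) (x : ℝ) :
    ∑ i ∈ Finset.range J, fejerWeight J i x = 1 := by
  have hJ' : (J : ℂ) ≠ 0 := by exact_mod_cast hJ.ne'
  apply Complex.ofReal_injective
  rw [Complex.ofReal_sum]
  simp only [ofReal_fejerWeight]
  rw [← Finset.mul_sum, Finset.sum_comm]
  have h : ∀ j ∈ Finset.range J, ∑ i ∈ Finset.range J, ∑ l ∈ Finset.range J,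
      expc (((j : ℝ) - l) * (x - i / J)) = J := by
    intro j hj
    rw [Finset.sum_comm]
    have h2 : ∀ l ∈ Finset.range J, ∑ i ∈ Finset.range J, expc (((j : ℝ) - l) * (x - i / J)) =
        if j = l then (J : ℂ) else 0 := by
      intro l hl
      have h3 : ∀ i ∈ Finset.range J, expc (((j : ℝ) - l) * (x - i / J)) =
          expc (((j : ℝ) - l) * x) * expc (i * (-((j : ℝ) - l) / J)) := by
        intro i _
        rw [← expc_add]
        congr 1
        ring
      rw [Finset.sum_congr rfl h3, ← Finset.mul_sum,
        sum_expc_div (Finset.mem_range.1 hj) (Finset.mem_range.1 hl)]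
      split_ifs with h4
      · subst h4
        simp [expc_zero]
      · simp
    rw [Finset.sum_congr rfl h2, Finset.sum_ite_eq, if_pos hj]
  rw [Finset.sum_congr rfl h]
  simp
  field_simp

/-- Correlation of a linear phase with a Fejér weight along an orbit of the rotation by `α`. -/
lemma norm_sum_expc_mul_fejerWeight_le {α θ δ : ℝ} {J : ℕ} (hJ : 0 < J) (hδ : 0 < δ)
    (h : ∀ j : ℤ, |j| < J → ∀ m : ℤ, δ ≤ |θ + j * α - m|) (s M i : ℕ) :
    ‖∑ n ∈ Finset.range M, expc (θ * ((s + n : ℕ) : ℝ)) *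
      (fejerWeight J i (((s + n : ℕ) : ℝ) * α) : ℂ)‖ ≤ 1 / (2 * δ) := by
  have hJ' : (J : ℝ) ≠ 0 := by positivity
  have h1 : ∑ n ∈ Finset.range M, expc (θ * ((s + n : ℕ) : ℝ)) *
      (fejerWeight J i (((s + n : ℕ) : ℝ) * α) : ℂ) =
      (1 / (J : ℂ) ^ 2) * ∑ j ∈ Finset.range J, ∑ l ∈ Finset.range J,
        expc (θ * s + ((j : ℝ) - l) * (s * α - i / J)) *
        ∑ n ∈ Finset.range M, expc (n * (θ + ((j : ℝ) - l) * α)) := by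
    simp only [ofReal_fejerWeight, Finset.mul_sum]
    rw [Finset.sum_comm]
    refine Finset.sum_congr rfl fun j _ => ?_
    rw [Finset.sum_comm]
    refine Finset.sum_congr rfl fun l _ => Finset.sum_congr rfl fun n _ => ?_
    rw [mul_left_comm, ← expc_add, ← expc_add]
    congr 2
    push_cast
    ring
  rw [h1, norm_mul]
  have h2 : ‖∑ j ∈ Finset.range J, ∑ l ∈ Finset.range J,
        expc (θ * s + ((j : ℝ) - l) * (s * α - i / J)) *
        ∑ n ∈ Finset.range M, expc (n * (θ + ((j : ℝ) - l) * α))‖ ≤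
      ∑ j ∈ Finset.range J, ∑ l ∈ Finset.range J, 1 / (2 * δ) := by
    refine norm_sum_le_of_le _ fun j hj => norm_sum_le_of_le _ fun l hl => ?_
    rw [norm_mul, norm_expc, one_mul]
    apply norm_sum_expc_le hδ
    intro m
    have := h ((j : ℤ) - l) (by
      rw [Finset.mem_range] at hj hl
      rw [abs_lt]
      constructor <;> omega) m
    push_cast at this
    exact this
  have h3 : ‖(1 / (J : ℂ) ^ 2)‖ = 1 / (J : ℝ) ^ 2 := by simp
  rw [h3]
  calc _ ≤ 1 / (J : ℝ) ^ 2 * ∑ j ∈ Finset.range J, ∑ l ∈ Finset.range J, 1 / (2 * δ) := by gcongr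
    _ = 1 / (2 * δ) := by
      simp
      field_simp

/-- Points of an orbit of a badly approximable rotation do not cluster. -/
lemma card_near_le {α c τ : ℝ} (hc : 0 < c) (hτ : 0 < τ)
    (hα : ∀ h : ℕ, 0 < h → ∀ m : ℤ, c ≤ h * |h * α - m|) (s M : ℕ) (p : ℝ) :
    (((Finset.range M).filter
      fun n => |Int.fract (((s + n : ℕ) : ℝ) * α) - p| ≤ τ).card : ℝ) ≤ 2 * M * τ / c + 1 := by
  set A := (Finset.range M).filter fun n => |Int.fract (((s + n : ℕ) : ℝ) * α) - p| ≤ τ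
  set g : ℝ := c / (2 * τ) with hg
  have hg0 : 0 < g := by positivity
  have hgap : ∀ n ∈ A, ∀ n' ∈ A, n < n' → g ≤ (n' : ℝ) - n := by
    intro n hn n' hn' hlt
    have e1 := (Finset.mem_filter.1 hn).2
    have e2 := (Finset.mem_filter.1 hn').2
    have e3 := hα (n' - n) (by omega)
      (⌊((s + n' : ℕ) : ℝ) * α⌋ - ⌊((s + n : ℕ) : ℝ) * α⌋)
    have e4 : ((n' - n : ℕ) : ℝ) = (n' : ℝ) - n := by
      rw [Nat.cast_sub hlt.le]
    rw [e4] at e3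
    have e5 : ((n' : ℝ) - n) * α -
        ((⌊((s + n' : ℕ) : ℝ) * α⌋ - ⌊((s + n : ℕ) : ℝ) * α⌋ : ℤ) : ℝ) =
        Int.fract (((s + n' : ℕ) : ℝ) * α) - Int.fract (((s + n : ℕ) : ℝ) * α) := by
      rw [Int.fract, Int.fract]
      push_cast
      ring
    rw [e5] at e3
    have e6 : |Int.fract (((s + n' : ℕ) : ℝ) * α) - Int.fract (((s + n : ℕ) : ℝ) * α)| ≤
        2 * τ := by
      rw [abs_le] at *
      constructor <;> linarith
    have e7 : (0 : ℝ) ≤ (n' : ℝ) - n := by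
      have : (n : ℝ) < n' := by exact_mod_cast hlt
      linarith
    rw [hg, div_le_iff₀ (by positivity)]
    nlinarith
  have hcard : A.card ≤ (Finset.range (⌊(M : ℝ) / g⌋₊ + 1)).card := by
    apply Finset.card_le_card_of_injOn (fun n : ℕ => ⌊(n : ℝ) / g⌋₊)
    · intro n hn
      have hn' : n < M := Finset.mem_range.1 (Finset.mem_filter.1 hn).1
      simp only [Finset.coe_range, Set.mem_Iio]
      apply Nat.lt_succ_of_le
      apply Nat.floor_le_floor
      gcongr
    · have key : ∀ n ∈ A, ∀ n' ∈ A, n < n' → ⌊(n : ℝ) / g⌋₊ ≠ ⌊(n' : ℝ) / g⌋₊ := by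
        intro n hn n' hn' hlt heq
        have e1 := hgap n hn n' hn' hlt
        have e2 : (n : ℝ) / g + 1 ≤ (n' : ℝ) / g := by
          rw [div_add_one hg0.ne']
          gcongr
          linarith
        have e3 := Nat.floor_le_floor e2
        rw [Nat.floor_add_one (by positivity)] at e3
        omega
      intro n hn n' hn' heq
      by_contra hne
      rcases lt_or_gt_of_ne hne with h | h
      · exact key n hn n' hn' h heq
      · exact key n' hn' n hn h heq.symm
  rw [Finset.card_range] at hcard
  have h1 : (A.card : ℝ) ≤ (⌊(M : ℝ) / g⌋₊ : ℝ) + 1 := by exact_mod_cast hcard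
  have h2 : (⌊(M : ℝ) / g⌋₊ : ℝ) ≤ M / g := Nat.floor_le (by positivity)
  have h3 : (M : ℝ) / g = 2 * M * τ / c := by
    rw [hg]
    field_simp
  linarith

/-- The linear phase `x ↦ e(βx)` cut off to the interval `[u, v)`. -/
noncomputable def cutPhase (β u v x : ℝ) : ℂ := if u ≤ x ∧ x < v then expc (β * x) else 0

lemma norm_cutPhase_le (β u v x : ℝ) : ‖cutPhase β u v x‖ ≤ 1 := by
  unfold cutPhase
  split_ifs
  · exact (norm_expc _).le
  · simp

lemma norm_cutPhase_sub_le_two (β u v x y : ℝ) :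
    ‖cutPhase β u v x - cutPhase β u v y‖ ≤ 2 := by
  have := norm_sub_le (cutPhase β u v x) (cutPhase β u v y)
  linarith [norm_cutPhase_le β u v x, norm_cutPhase_le β u v y]

lemma norm_cutPhase_sub_le {β u v x y τ : ℝ} (hxy : |x - y| ≤ τ) (hu : τ < |x - u|)
    (hv : τ < |x - v|) :
    ‖cutPhase β u v x - cutPhase β u v y‖ ≤ 2 * Real.pi * |β| * τ := by
  have hτ : 0 ≤ τ := (abs_nonneg _).trans hxy
  have h1 : (u ≤ x ↔ u ≤ y) := by
    rw [abs_le] at hxy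
    rw [lt_abs] at hu
    constructor <;> intro _ <;> rcases hu with hu | hu <;> linarith
  have h2 : (x < v ↔ y < v) := by
    rw [abs_le] at hxy
    rw [lt_abs] at hv
    constructor <;> intro _ <;> rcases hv with hv | hv <;> linarith
  simp only [cutPhase, h1, h2]
  split_ifs
  · refine (norm_expc_sub_expc_le _ _).trans ?_
    rw [← mul_sub, abs_mul, ← mul_assoc]
    gcongr
  · simp only [sub_self, norm_zero]
    have := Real.pi_pos
    positivity

lemma cutPhase_sub_sum {J : ℕ} (hJ : 0 < J) (β u v x y : ℝ) :
    cutPhase β u v y - ∑ i ∈ Finset.range J, (fejerWeight J i x : ℂ) * cutPhase β u v (i / J) =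
      ∑ i ∈ Finset.range J,
        (fejerWeight J i x : ℂ) * (cutPhase β u v y - cutPhase β u v (i / J)) := by
  simp only [mul_sub, Finset.sum_sub_distrib, ← Finset.sum_mul]
  rw [← Complex.ofReal_sum, sum_fejerWeight hJ]
  simp

lemma norm_cutPhase_sub_sum_le_two {J : ℕ} (hJ : 0 < J) (β u v x y : ℝ) :
    ‖cutPhase β u v y -
      ∑ i ∈ Finset.range J, (fejerWeight J i x : ℂ) * cutPhase β u v (i / J)‖ ≤ 2 := by
  rw [cutPhase_sub_sum hJ]
  calc _ ≤ ∑ i ∈ Finset.range J, fejerWeight J i x * 2 := by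
        refine norm_sum_le_of_le _ fun i _ => ?_
        rw [norm_mul, Complex.norm_real, Real.norm_of_nonneg (fejerWeight_nonneg _ _ _)]
        exact mul_le_mul_of_nonneg_left (norm_cutPhase_sub_le_two _ _ _ _ _)
          (fejerWeight_nonneg _ _ _)
    _ = 2 := by rw [← Finset.sum_mul, sum_fejerWeight hJ, one_mul]

/-- Away from the discontinuities, Fejér means approximate a cut-off phase. -/
lemma norm_cutPhase_fract_sub_sum_le {J : ℕ} (hJ : 0 < J) {β u v x τ : ℝ} (hτ : 0 < τ)
    (h0 : τ < |Int.fract x - 0|) (h1 : τ < |Int.fract x - 1|)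
    (hu : τ < |Int.fract x - u|) (hv : τ < |Int.fract x - v|) :
    ‖cutPhase β u v (Int.fract x) -
      ∑ i ∈ Finset.range J, (fejerWeight J i x : ℂ) * cutPhase β u v (i / J)‖ ≤
      2 * Real.pi * |β| * τ + 1 / (2 * J * τ ^ 2) := by
  have hJ' : (0 : ℝ) < J := by exact_mod_cast hJ
  have hf0 := Int.fract_nonneg x
  have hf1 := Int.fract_lt_one x
  have hpi := Real.pi_pos
  rw [sub_zero, abs_of_nonneg hf0] at h0
  rw [abs_of_neg (by linarith)] at h1
  rw [cutPhase_sub_sum hJ]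
  calc _ ≤ ∑ i ∈ Finset.range J,
        (fejerWeight J i x * (2 * Real.pi * |β| * τ) + 1 / (2 * J ^ 2 * τ ^ 2)) := by
        refine norm_sum_le_of_le _ fun i hi => ?_
        rw [norm_mul, Complex.norm_real, Real.norm_of_nonneg (fejerWeight_nonneg _ _ _)]
        have hw := fejerWeight_nonneg J i x
        by_cases hfar : ∀ m : ℤ, τ ≤ |x - i / J - m|
        · have e1 := fejerWeight_le hτ hfar
          have e2 : fejerWeight J i x *
              ‖cutPhase β u v (Int.fract x) - cutPhase β u v (i / J)‖ ≤
              1 / (4 * J ^ 2 * τ ^ 2) * 2 := by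
            gcongr
            exact norm_cutPhase_sub_le_two _ _ _ _ _
          have e3 : 1 / (4 * (J : ℝ) ^ 2 * τ ^ 2) * 2 = 1 / (2 * J ^ 2 * τ ^ 2) := by
            field_simp
            norm_num
          have e4 : 0 ≤ fejerWeight J i x * (2 * Real.pi * |β| * τ) := by positivity
          linarith
        · push Not at hfar
          obtain ⟨m, hm⟩ := hfar
          have hi0 : (0 : ℝ) ≤ i / J := by positivity
          have hi1 : (i : ℝ) / J < 1 := by
            rw [div_lt_one hJ']
            exact_mod_cast Finset.mem_range.1 hi
          have hxf : x = Int.fract x + ⌊x⌋ := (Int.fract_add_floor x).symm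
          have hm0 : m - ⌊x⌋ = 0 := by
            by_contra hne
            rw [abs_lt] at hm
            rcases lt_or_gt_of_ne hne with hlt | hgt
            · have : ((m - ⌊x⌋ : ℤ) : ℝ) ≤ -1 := by
                exact_mod_cast Int.le_sub_one_of_lt hlt
              push_cast at this
              linarith [hm.2]
            · have : (1 : ℝ) ≤ ((m - ⌊x⌋ : ℤ) : ℝ) := by exact_mod_cast hgt
              push_cast at this
              linarith [hm.1]
          have hm' : (m : ℝ) = ⌊x⌋ := by
            have : m = ⌊x⌋ := by linarith
            exact_mod_cast this
          have hxy : |Int.fract x - i / J| ≤ τ := by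
            have : Int.fract x - i / J = x - i / J - m := by
              rw [hm', Int.fract]
              ring
            rw [this]
            exact hm.le
          have e1 := norm_cutPhase_sub_le (β := β) hxy hu hv
          have e2 := mul_le_mul_of_nonneg_left e1 hw
          have e3 : 0 ≤ 1 / (2 * (J : ℝ) ^ 2 * τ ^ 2) := by positivity
          linarith
    _ = 2 * Real.pi * |β| * τ + 1 / (2 * J * τ ^ 2) := by
        rw [Finset.sum_add_distrib, ← Finset.sum_mul, sum_fejerWeight hJ]
        simp
        field_simp

/-- Twisted sums of a cut-off phase along the orbit of a badly approximable rotation. -/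
lemma norm_sum_expc_mul_cutPhase_le {α c τ δ θ : ℝ} {J : ℕ} (hc : 0 < c) (hτ : 0 < τ)
    (hα : ∀ h : ℕ, 0 < h → ∀ m : ℤ, c ≤ h * |h * α - m|) (hJ : 0 < J) (hδ : 0 < δ)
    (h : ∀ j : ℤ, |j| < J → ∀ m : ℤ, δ ≤ |θ + j * α - m|) (β u v : ℝ) (s M : ℕ) :
    ‖∑ n ∈ Finset.range M, expc (θ * ((s + n : ℕ) : ℝ)) *
      cutPhase β u v (Int.fract (((s + n : ℕ) : ℝ) * α))‖ ≤
      J / (2 * δ) + M * (2 * Real.pi * |β| * τ + 1 / (2 * J * τ ^ 2)) +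
        8 * (2 * M * τ / c + 1) := by
  set x : ℕ → ℝ := fun n => ((s + n : ℕ) : ℝ) * α with hx
  set E := 2 * Real.pi * |β| * τ + 1 / (2 * J * τ ^ 2) with hE
  have hpi := Real.pi_pos
  have hE0 : 0 ≤ E := by positivity
  set P : ℕ → ℂ := fun n => ∑ i ∈ Finset.range J,
    (fejerWeight J i (x n) : ℂ) * cutPhase β u v (i / J) with hP
  have hmain : ‖∑ n ∈ Finset.range M, expc (θ * ((s + n : ℕ) : ℝ)) * P n‖ ≤ J / (2 * δ) := by
    have e1 : ∑ n ∈ Finset.range M, expc (θ * ((s + n : ℕ) : ℝ)) * P n =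
        ∑ i ∈ Finset.range J, cutPhase β u v (i / J) * ∑ n ∈ Finset.range M,
          expc (θ * ((s + n : ℕ) : ℝ)) * (fejerWeight J i (x n) : ℂ) := by
      simp only [hP, Finset.mul_sum]
      rw [Finset.sum_comm]
      refine Finset.sum_congr rfl fun i _ => Finset.sum_congr rfl fun n _ => ?_
      ring
    rw [e1]
    calc _ ≤ ∑ i ∈ Finset.range J, 1 / (2 * δ) := by
          refine norm_sum_le_of_le _ fun i _ => ?_
          rw [norm_mul]
          calc _ ≤ 1 * (1 / (2 * δ)) := by
                gcongr
                · exact norm_cutPhase_le _ _ _ _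
                · exact norm_sum_expc_mul_fejerWeight_le hJ hδ h s M i
            _ = _ := one_mul _
      _ = J / (2 * δ) := by
          simp
          ring
  let near : ℝ → ℕ → ℝ := fun p n => if |Int.fract (x n) - p| ≤ τ then 1 else 0
  have hnear0 : ∀ p n, 0 ≤ near p n := by
    intro p n
    simp only [near]
    split_ifs <;> norm_num
  have hpt : ∀ n, ‖cutPhase β u v (Int.fract (x n)) - P n‖ ≤
      E + 2 * (near 0 n + near 1 n + near u n + near v n) := by
    intro n
    by_cases hbad : τ < |Int.fract (x n) - 0| ∧ τ < |Int.fract (x n) - 1| ∧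
        τ < |Int.fract (x n) - u| ∧ τ < |Int.fract (x n) - v|
    · obtain ⟨b0, b1, bu, bv⟩ := hbad
      have := norm_cutPhase_fract_sub_sum_le hJ (β := β) hτ b0 b1 bu bv
      linarith [hnear0 0 n, hnear0 1 n, hnear0 u n, hnear0 v n]
    · have h2 := norm_cutPhase_sub_sum_le_two hJ β u v (x n) (Int.fract (x n))
      have h3 : 1 ≤ near 0 n + near 1 n + near u n + near v n := by
        have hone : ∀ p, ¬ (τ < |Int.fract (x n) - p|) → near p n = 1 := by
          intro p hp
          simp only [near]
          rw [if_pos (not_lt.1 hp)]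
        by_contra hlt
        apply hbad
        refine ⟨?_, ?_, ?_, ?_⟩ <;> by_contra hcon <;> have := hone _ hcon <;>
          linarith [hnear0 0 n, hnear0 1 n, hnear0 u n, hnear0 v n]
      linarith
  have hcount : ∀ p, ∑ n ∈ Finset.range M, near p n ≤ 2 * M * τ / c + 1 := by
    intro p
    simp only [near]
    rw [Finset.sum_ite, Finset.sum_const_zero, add_zero, Finset.sum_const, nsmul_eq_mul, mul_one]
    exact card_near_le hc hτ hα s M p
  have herr : ‖∑ n ∈ Finset.range M, expc (θ * ((s + n : ℕ) : ℝ)) *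
      (cutPhase β u v (Int.fract (x n)) - P n)‖ ≤ M * E + 8 * (2 * M * τ / c + 1) := by
    calc _ ≤ ∑ n ∈ Finset.range M, (E + 2 * (near 0 n + near 1 n + near u n + near v n)) := by
          refine norm_sum_le_of_le _ fun n _ => ?_
          rw [norm_mul, norm_expc, one_mul]
          exact hpt n
      _ = M * E + 2 * (∑ n ∈ Finset.range M, near 0 n + ∑ n ∈ Finset.range M, near 1 n +
            ∑ n ∈ Finset.range M, near u n + ∑ n ∈ Finset.range M, near v n) := by
          rw [Finset.sum_add_distrib, ← Finset.mul_sum]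
          simp only [Finset.sum_add_distrib]
          simp
      _ ≤ _ := by linarith [hcount 0, hcount 1, hcount u, hcount v]
  have hsplit : ∑ n ∈ Finset.range M, expc (θ * ((s + n : ℕ) : ℝ)) *
      cutPhase β u v (Int.fract (x n)) =
      ∑ n ∈ Finset.range M, expc (θ * ((s + n : ℕ) : ℝ)) * P n +
      ∑ n ∈ Finset.range M, expc (θ * ((s + n : ℕ) : ℝ)) *
      (cutPhase β u v (Int.fract (x n)) - P n) := by
    rw [← Finset.sum_add_distrib]
    refine Finset.sum_congr rfl fun n _ => ?_
    ring
  rw [hsplit]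
  refine (norm_add_le _ _).trans ?_
  linarith

/-- Van der Corput's inequality. -/
lemma van_der_corput {a : ℕ → ℂ} (ha : ∀ n, ‖a n‖ ≤ 1) {M R : ℕ} {K : ℝ} (hK : 0 ≤ K)
    (h : ∀ s d, 1 ≤ d → d < R →
      ‖∑ n ∈ Finset.range M, a (s + n + d) * (starRingEnd ℂ) (a (s + n))‖ ≤ K) :
    R * ‖∑ n ∈ Finset.range M, a n‖ ≤ √(M * (R * M + R ^ 2 * K)) + 2 * R ^ 2 := by
  set S := ∑ n ∈ Finset.range M, a n with hS
  set b : ℕ → ℂ := fun n => ∑ l ∈ Finset.range R, a (n + l) with hb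
  have hshift : ∀ l, ‖S - ∑ n ∈ Finset.range M, a (n + l)‖ ≤ 2 * l := by
    intro l
    have e1 : S - ∑ n ∈ Finset.range M, a (n + l) =
        ∑ n ∈ Finset.range l, a n - ∑ n ∈ Finset.range l, a (M + n) := by
      have e2 := Finset.sum_range_add a M l
      have e3 := Finset.sum_range_add a l M
      rw [add_comm l M] at e3
      simp only [add_comm _ l]
      rw [hS]
      linear_combination e3 - e2
    rw [e1]
    have hl : ∀ f : ℕ → ℂ, (∀ n, ‖f n‖ ≤ 1) → ‖∑ n ∈ Finset.range l, f n‖ ≤ l := by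
      intro f hf
      calc _ ≤ ∑ n ∈ Finset.range l, (1 : ℝ) := norm_sum_le_of_le _ fun n _ => hf n
        _ = l := by simp
    refine (norm_sub_le _ _).trans ?_
    linarith [hl a ha, hl (fun n => a (M + n)) fun n => ha _]
  have hB : ‖R * S - ∑ n ∈ Finset.range M, b n‖ ≤ 2 * R ^ 2 := by
    have e1 : R * S - ∑ n ∈ Finset.range M, b n =
        ∑ l ∈ Finset.range R, (S - ∑ n ∈ Finset.range M, a (n + l)) := by
      rw [hb, Finset.sum_comm, Finset.sum_sub_distrib]
      simp
    rw [e1]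
    calc _ ≤ ∑ l ∈ Finset.range R, (2 * R : ℝ) := by
          refine norm_sum_le_of_le _ fun l hl => (hshift l).trans ?_
          have : (l : ℝ) ≤ R := by exact_mod_cast (Finset.mem_range.1 hl).le
          linarith
      _ = _ := by
          simp
          ring
  have hsq : ∑ n ∈ Finset.range M, ‖b n‖ ^ 2 ≤ R * M + R ^ 2 * K := by
    have e1 : ((∑ n ∈ Finset.range M, ‖b n‖ ^ 2 : ℝ) : ℂ) =
        ∑ l ∈ Finset.range R, ∑ l' ∈ Finset.range R,
          ∑ n ∈ Finset.range M, a (n + l) * (starRingEnd ℂ) (a (n + l')) := by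
      rw [Complex.ofReal_sum]
      have : ∀ n ∈ Finset.range M, ((‖b n‖ ^ 2 : ℝ) : ℂ) = ∑ l ∈ Finset.range R,
          ∑ l' ∈ Finset.range R, a (n + l) * (starRingEnd ℂ) (a (n + l')) := by
        intro n _
        rw [Complex.ofReal_pow, ← Complex.mul_conj', hb, map_sum, Finset.sum_mul_sum]
      rw [Finset.sum_congr rfl this, Finset.sum_comm]
      refine Finset.sum_congr rfl fun l _ => ?_
      rw [Finset.sum_comm]
    have e2 : ∀ l ∈ Finset.range R, ∀ l' ∈ Finset.range R,
        ‖∑ n ∈ Finset.range M, a (n + l) * (starRingEnd ℂ) (a (n + l'))‖ ≤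
          (if l = l' then (M : ℝ) else 0) + K := by
      have key : ∀ l ∈ Finset.range R, ∀ l', l' < l →
          ‖∑ n ∈ Finset.range M, a (n + l) * (starRingEnd ℂ) (a (n + l'))‖ ≤ K := by
        intro l hl l' hlt
        have := h l' (l - l') (by omega) (by have := Finset.mem_range.1 hl; omega)
        convert this using 4 with n hn
        · congr 1
          omega
        · rw [add_comm]
      intro l hl l' hl'
      rcases lt_trichotomy l l' with hlt | heq | hgt
      · rw [if_neg hlt.ne, zero_add]
        have := key l' hl' l hlt
        rw [← Complex.norm_conj] at this
        simpa [map_sum, mul_comm] using this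
      · rw [if_pos heq]
        subst heq
        have : ‖∑ n ∈ Finset.range M, a (n + l) * (starRingEnd ℂ) (a (n + l))‖ ≤ M := by
          calc _ ≤ ∑ n ∈ Finset.range M, (1 : ℝ) := by
                refine norm_sum_le_of_le _ fun n _ => ?_
                rw [norm_mul, Complex.norm_conj]
                nlinarith [ha (n + l), norm_nonneg (a (n + l))]
            _ = M := by simp
        linarith
      · rw [if_neg hgt.ne', zero_add]
        exact key l hl l' hgt
    have e3 : ∑ n ∈ Finset.range M, ‖b n‖ ^ 2 =
        ‖((∑ n ∈ Finset.range M, ‖b n‖ ^ 2 : ℝ) : ℂ)‖ := by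
      rw [Complex.norm_real, Real.norm_of_nonneg (Finset.sum_nonneg fun n _ => by positivity)]
    rw [e3, e1]
    calc _ ≤ ∑ l ∈ Finset.range R, ∑ l' ∈ Finset.range R,
          ((if l = l' then (M : ℝ) else 0) + K) :=
          norm_sum_le_of_le _ fun l hl => norm_sum_le_of_le _ fun l' hl' => e2 l hl l' hl'
      _ = R * M + R ^ 2 * K := by
          have : ∀ l ∈ Finset.range R, ∑ l' ∈ Finset.range R,
              ((if l = l' then (M : ℝ) else 0) + K) = M + R * K := by
            intro l hl
            rw [Finset.sum_add_distrib, Finset.sum_ite_eq, if_pos hl]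
            simp
          rw [Finset.sum_congr rfl this]
          simp
          ring
  have hCS : ‖∑ n ∈ Finset.range M, b n‖ ≤ √(M * (R * M + R ^ 2 * K)) := by
    apply Real.le_sqrt_of_sq_le
    calc _ ≤ (∑ n ∈ Finset.range M, ‖b n‖) ^ 2 := by
          gcongr
          exact norm_sum_le _ _
      _ ≤ M * ∑ n ∈ Finset.range M, ‖b n‖ ^ 2 := by
          have := sq_sum_le_card_mul_sum_sq (s := Finset.range M) (f := fun n => ‖b n‖)
          simpa using this
      _ ≤ _ := by gcongr
  have h1 : (R : ℝ) * ‖S‖ = ‖(R : ℂ) * S‖ := by simp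
  have h2 := norm_add_le (∑ n ∈ Finset.range M, b n) (R * S - ∑ n ∈ Finset.range M, b n)
  rw [add_sub_cancel] at h2
  rw [h1]
  linarith

lemma floor_add_mul_cases (x y : ℝ) :
    (Int.fract x < 1 - Int.fract y ∧ ⌊x + y⌋ = ⌊x⌋ + ⌊y⌋) ∨
      (1 - Int.fract y ≤ Int.fract x ∧ ⌊x + y⌋ = ⌊x⌋ + ⌊y⌋ + 1) := by
  have hx := Int.fract_add_floor x
  have hy := Int.fract_add_floor y
  have hx0 := Int.fract_nonneg x
  have hy0 := Int.fract_nonneg y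
  have hx1 := Int.fract_lt_one x
  have hy1 := Int.fract_lt_one y
  rcases lt_or_ge (Int.fract x) (1 - Int.fract y) with h | h
  · left
    refine ⟨h, ?_⟩
    rw [Int.floor_eq_iff]
    push_cast
    constructor <;> linarith
  · right
    refine ⟨h, ?_⟩
    rw [Int.floor_eq_iff]
    push_cast
    constructor <;> linarith

/-- Differencing the phase `ξ n ⌊nα⌋` produces linear phases cut off by the fractional part. -/
lemma expc_mul_conj_shift (ξ α : ℝ) (n d : ℕ) :
    expc (ξ * (((n + d : ℕ) : ℝ) * (⌊((n + d : ℕ) : ℝ) * α⌋ : ℝ))) *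
      (starRingEnd ℂ) (expc (ξ * ((n : ℝ) * (⌊(n : ℝ) * α⌋ : ℝ)))) =
    expc (ξ * (d * ((⌊d * α⌋ : ℝ) + (0 : ℤ)))) *
      (expc (ξ * ((⌊d * α⌋ : ℝ) + (0 : ℤ) + d * α) * n) *
        cutPhase (-(ξ * d)) 0 (1 - Int.fract (d * α)) (Int.fract (n * α))) +
    expc (ξ * (d * ((⌊d * α⌋ : ℝ) + (1 : ℤ)))) *
      (expc (ξ * ((⌊d * α⌋ : ℝ) + (1 : ℤ) + d * α) * n) *
        cutPhase (-(ξ * d)) (1 - Int.fract (d * α)) 1 (Int.fract (n * α))) := by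
  have hsplit : ((n + d : ℕ) : ℝ) * α = n * α + d * α := by
    push_cast
    ring
  have hf0 := Int.fract_nonneg ((n : ℝ) * α)
  have hf1 := Int.fract_lt_one ((n : ℝ) * α)
  rw [hsplit, conj_expc, ← expc_add]
  unfold cutPhase
  rcases floor_add_mul_cases (n * α) (d * α) with ⟨h, hfl⟩ | ⟨h, hfl⟩
  · rw [if_pos ⟨hf0, h⟩, if_neg (by rintro ⟨h1, _⟩; linarith), mul_zero, mul_zero, add_zero,
      ← expc_add, ← expc_add, hfl]
    congr 1
    rw [Int.fract]
    push_cast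
    ring
  · rw [if_neg (by rintro ⟨_, h1⟩; linarith), if_pos ⟨h, hf1⟩, mul_zero, mul_zero, zero_add,
      ← expc_add, ← expc_add, hfl]
    congr 1
    rw [Int.fract]
    push_cast
    ring

lemma norm_correlation_le {α c ξ : ℝ} {M R d : ℕ} (hc : 0 < c)
    (hα : ∀ h : ℕ, 0 < h → ∀ m : ℤ, c ≤ h * |h * α - m|) (hξ : |ξ| ≤ 1 / 2)
    (hR : 0 < R) (hRM : R ≤ M) (hd : d < R)
    (h : ∀ e : ℤ, (e = 0 ∨ e = 1) → ∀ j : ℤ, |j| < (R ^ 5 : ℕ) → ∀ m : ℤ,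
      (R : ℝ) ^ 6 / M ≤ |ξ * ((⌊d * α⌋ : ℝ) + e + d * α) + j * α - m|) (s : ℕ) :
    ‖∑ n ∈ Finset.range M,
      expc (ξ * (((s + n + d : ℕ) : ℝ) * (⌊((s + n + d : ℕ) : ℝ) * α⌋ : ℝ))) *
      (starRingEnd ℂ) (expc (ξ * (((s + n : ℕ) : ℝ) * (⌊((s + n : ℕ) : ℝ) * α⌋ : ℝ))))‖ ≤
      M / R * (36 + 32 / c) := by
  have hR' : (1 : ℝ) ≤ R := by exact_mod_cast hR
  have hM' : (R : ℝ) ≤ M := by exact_mod_cast hRM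
  have hM0 : (0 : ℝ) < M := by linarith
  have hδ : 0 < (R : ℝ) ^ 6 / M := by positivity
  have hβ : |-(ξ * d)| ≤ R := by
    rw [abs_neg, abs_mul, Nat.abs_cast]
    have : (d : ℝ) ≤ R := by exact_mod_cast hd.le
    nlinarith [abs_nonneg ξ]
  have key : ∀ e : ℤ, (e = 0 ∨ e = 1) → ∀ u v : ℝ,
      ‖∑ n ∈ Finset.range M, expc (ξ * ((⌊d * α⌋ : ℝ) + e + d * α) * ((s + n : ℕ) : ℝ)) *
        cutPhase (-(ξ * d)) u v (Int.fract (((s + n : ℕ) : ℝ) * α))‖ ≤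
      M / R * (18 + 16 / c) := by
    intro e he u v
    have hτ : (0 : ℝ) < 1 / (R : ℝ) ^ 2 := by positivity
    refine (norm_sum_expc_mul_cutPhase_le hc hτ hα (pow_pos hR 5) hδ
      (fun j hj m => h e he j hj m) (-(ξ * d)) u v s M).trans ?_
    have hpi := Real.pi_pos
    have hpi4 := Real.pi_lt_four
    have e1 : ((R ^ 5 : ℕ) : ℝ) / (2 * ((R : ℝ) ^ 6 / M)) = M / R * (1 / 2) := by
      push_cast
      field_simp
    have e2 : M * (2 * Real.pi * |-(ξ * d)| * (1 / (R : ℝ) ^ 2) +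
        1 / (2 * ((R ^ 5 : ℕ) : ℝ) * (1 / (R : ℝ) ^ 2) ^ 2)) ≤
        M * (2 * Real.pi * R * (1 / (R : ℝ) ^ 2) +
        1 / (2 * ((R ^ 5 : ℕ) : ℝ) * (1 / (R : ℝ) ^ 2) ^ 2)) := by gcongr
    have e3 : M * (2 * Real.pi * R * (1 / (R : ℝ) ^ 2) +
        1 / (2 * ((R ^ 5 : ℕ) : ℝ) * (1 / (R : ℝ) ^ 2) ^ 2)) =
        M / R * (2 * Real.pi + 1 / 2) := by
      push_cast
      field_simp
    have e4 : 2 * M * (1 / (R : ℝ) ^ 2) / c ≤ M / R * (2 / c) := by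
      have : 2 * M * (1 / (R : ℝ) ^ 2) / c = M / R * (2 / c) * (1 / R) := by field_simp
      rw [this]
      apply mul_le_of_le_one_right (by positivity)
      rw [div_le_one (by positivity)]
      exact hR'
    have e5 : 1 ≤ (M : ℝ) / R := by
      rw [le_div_iff₀ (by positivity)]
      linarith
    have e6 : (M : ℝ) / R * (2 * Real.pi) ≤ M / R * 8 := by
      gcongr
      linarith
    have e7 : (M : ℝ) / R * (18 + 16 / c) = M / R * (1 / 2) + (M / R * 8 + M / R * (1 / 2)) +
      8 * (M / R * (2 / c)) + 9 * (M / R) := by ring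
    rw [e1, e7]
    linarith
  simp only [expc_mul_conj_shift, Finset.sum_add_distrib, ← Finset.mul_sum]
  refine (norm_add_le _ _).trans ?_
  rw [norm_mul, norm_mul, norm_expc, norm_expc, one_mul, one_mul]
  have k0 := key 0 (Or.inl rfl) 0 (1 - Int.fract (d * α))
  have k1 := key 1 (Or.inr rfl) (1 - Int.fract (d * α)) 1
  have e8 : (M : ℝ) / R * (36 + 32 / c) = M / R * (18 + 16 / c) + M / R * (18 + 16 / c) := by ring
  rw [e8]
  exact add_le_add k0 k1

/-- Cancellation in the exponential sum when all differenced frequencies avoid `ℤ + αℤ`. -/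
lemma norm_sum_Icc_expc_le {α c ξ : ℝ} {M R : ℕ} (hc : 0 < c)
    (hα : ∀ h : ℕ, 0 < h → ∀ m : ℤ, c ≤ h * |h * α - m|) (hξ : |ξ| ≤ 1 / 2)
    (hR : 0 < R) (hRM : R ^ 2 ≤ M)
    (h : ∀ d : ℕ, 1 ≤ d → d < R → ∀ e : ℤ, (e = 0 ∨ e = 1) → ∀ j : ℤ, |j| < (R ^ 5 : ℕ) →
      ∀ m : ℤ, (R : ℝ) ^ 6 / M ≤ |ξ * ((⌊d * α⌋ : ℝ) + e + d * α) + j * α - m|) :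
    ‖∑ n ∈ Finset.Icc 1 M, expc (ξ * ((n : ℝ) * (⌊(n : ℝ) * α⌋ : ℝ)))‖ ≤
      (√(37 + 32 / c) + 2) * M / √R := by
  have hR' : (1 : ℝ) ≤ R := by exact_mod_cast hR
  have hM' : (R : ℝ) ^ 2 ≤ M := by exact_mod_cast hRM
  set a : ℕ → ℂ := fun n => expc (ξ * (((n + 1 : ℕ) : ℝ) * (⌊((n + 1 : ℕ) : ℝ) * α⌋ : ℝ)))
    with ha
  have hS : ∑ n ∈ Finset.Icc 1 M, expc (ξ * ((n : ℝ) * (⌊(n : ℝ) * α⌋ : ℝ))) =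
      ∑ n ∈ Finset.range M, a n := by
    rw [Finset.range_eq_Ico, Finset.sum_Ico_add' (fun n : ℕ =>
      expc (ξ * ((n : ℝ) * (⌊(n : ℝ) * α⌋ : ℝ)))) 0 M 1]
    rfl
  rw [hS]
  have hK : 0 ≤ (M : ℝ) / R * (36 + 32 / c) := by positivity
  have hvdc := van_der_corput (a := a) (fun n => (norm_expc _).le) (M := M) (R := R) hK (by
    intro s d hd1 hd
    have := norm_correlation_le hc hα hξ hR (by nlinarith) hd (h d hd1 hd) (s + 1)
    convert this using 5 with n hn
    · rw [show s + n + d + 1 = s + 1 + n + d by ring]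
    · simp only [ha]
      rw [show s + n + 1 = s + 1 + n by ring])
  have e1 : (M : ℝ) * (R * M + R ^ 2 * (M / R * (36 + 32 / c))) =
      (M : ℝ) ^ 2 * R * (37 + 32 / c) := by
    field_simp
    ring
  have hsq : √(R : ℝ) * √R = R := Real.mul_self_sqrt (by positivity)
  have hs1 : 1 ≤ √(R : ℝ) := Real.one_le_sqrt.2 hR'
  rw [e1, Real.sqrt_mul (by positivity), Real.sqrt_mul (by positivity),
    Real.sqrt_sq (by positivity)] at hvdc
  rw [le_div_iff₀ (by positivity)]
  have e2 : 2 * (R : ℝ) ^ 2 ≤ 2 * M * √R := by nlinarith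
  refine le_of_mul_le_mul_right ?_ (show 0 < √(R : ℝ) by positivity)
  rw [mul_assoc, hsq]
  linarith

/-- The square root of a rational number is badly approximable. -/
lemma exists_badly_approximable {k : ℚ} (hk : 0 < k) (hirr : Irrational √(k : ℝ)) :
    ∃ c > (0 : ℝ), ∀ h : ℕ, 0 < h → ∀ m : ℤ, c ≤ h * |h * √(k : ℝ) - m| := by
  set α := √(k : ℝ) with hαdef
  have hk' : (0 : ℝ) < k := by exact_mod_cast hk
  have hα0 : 0 < α := Real.sqrt_pos.2 hk'
  have hsq : α ^ 2 = k := Real.sq_sqrt hk'.le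
  have hr : (0 : ℝ) < k.den := by exact_mod_cast k.den_pos
  have hr1 : (1 : ℝ) ≤ k.den := by exact_mod_cast k.den_pos
  have hkd : (k : ℝ) * k.den = k.num := by exact_mod_cast Rat.mul_den_eq_num k
  refine ⟨1 / (k.den * (2 * α + 1)), by positivity, fun h hh m => ?_⟩
  have hh1 : (1 : ℝ) ≤ h := by exact_mod_cast hh
  rw [div_le_iff₀ (by positivity)]
  rcases le_or_gt 1 |h * α - m| with hbig | hsmall
  · have e1 : (1 : ℝ) ≤ k.den * (2 * α + 1) := by nlinarith
    have e2 : 1 ≤ (h : ℝ) * |h * α - m| := by nlinarith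
    nlinarith
  · have e1 : |(h : ℝ) * α + m| ≤ h * (2 * α + 1) := by
      rw [abs_lt] at hsmall
      rw [abs_le]
      constructor <;> nlinarith
    have hne : (k.num * h ^ 2 - k.den * m ^ 2 : ℤ) ≠ 0 := by
      intro h0
      have h1 : (k.num : ℝ) * h ^ 2 - k.den * m ^ 2 = 0 := by exact_mod_cast h0
      have h2 : ((h : ℝ) * α - m) * (h * α + m) = 0 := by
        have : (k.den : ℝ) * (((h : ℝ) * α - m) * (h * α + m)) = 0 := by
          rw [← h1, ← hkd, ← hsq]
          ring
        rcases mul_eq_zero.1 this with h3 | h3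
        · exact absurd h3 hr.ne'
        · exact h3
      have hir : Irrational ((h : ℝ) * α) := hirr.natCast_mul hh.ne'
      rcases mul_eq_zero.1 h2 with h3 | h3
      · exact hir.ne_int m (by linarith)
      · exact hir.ne_int (-m) (by push_cast; linarith)
    have h1 : (1 : ℝ) ≤ |(k.num : ℝ) * h ^ 2 - k.den * m ^ 2| := by
      exact_mod_cast Int.one_le_abs hne
    have h2 : (k.num : ℝ) * h ^ 2 - k.den * m ^ 2 =
        k.den * (((h : ℝ) * α - m) * (h * α + m)) := by
      rw [← hkd, ← hsq]
      ring
    rw [h2, abs_mul, abs_mul, abs_of_pos hr] at h1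
    calc 1 ≤ (k.den : ℝ) * (|h * α - m| * |h * α + m|) := h1
      _ ≤ k.den * (|h * α - m| * (h * (2 * α + 1))) := by gcongr
      _ = _ := by ring

lemma mem_wideArcs_of_pos {k N γ ξ : ℝ} (hξ : ξ ∈ Set.Ico (-(1 / 2) : ℝ) (1 / 2)) {A B : ℤ}
    {Q : ℕ} (hQ : 0 < Q) (hQN : (Q : ℝ) ≤ N ^ γ) (hBN : |(B : ℝ)| ≤ N ^ γ)
    (h : |ξ - ((A : ℝ) + B * √k) / Q| ≤ N ^ (-1 + γ)) : ξ ∈ wideArcs k N γ := by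
  obtain ⟨g, hg⟩ : ∃ g : ℕ, g = Int.gcd A (Int.gcd B (Q : ℤ)) := ⟨_, rfl⟩
  have hg0 : 0 < g := by
    rw [hg]
    apply Int.gcd_pos_of_ne_zero_right
    have : 0 < Int.gcd B (Q : ℤ) := Int.gcd_pos_of_ne_zero_right _ (by exact_mod_cast hQ.ne')
    exact_mod_cast this.ne'
  have hgA : (g : ℤ) ∣ A := by
    rw [hg]
    exact Int.gcd_dvd_left ..
  have hgG : (g : ℤ) ∣ (Int.gcd B (Q : ℤ) : ℤ) := by
    rw [hg]
    exact Int.gcd_dvd_right ..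
  obtain ⟨A', rfl⟩ := hgA
  obtain ⟨B', rfl⟩ := hgG.trans (Int.gcd_dvd_left ..)
  obtain ⟨Q', rfl⟩ : g ∣ Q := by
    exact_mod_cast hgG.trans (Int.gcd_dvd_right ..)
  have hQ' : 0 < Q' := Nat.pos_of_mul_pos_left hQ
  have hcop : Int.gcd A' (Int.gcd B' (Q' : ℤ)) = 1 := by
    have e1 : Int.gcd ((g : ℤ) * B') ((g * Q' : ℕ) : ℤ) = g * Int.gcd B' Q' := by
      push_cast
      rw [Int.gcd_mul_left]
      simp
    rw [e1] at hg
    push_cast at hg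
    rw [Int.gcd_mul_left] at hg
    simp only [Int.natAbs_natCast] at hg
    exact Nat.eq_of_mul_eq_mul_left hg0 (by rw [mul_one]; exact hg.symm)
  have hQ'0 : (0 : ℝ) < Q' := by exact_mod_cast hQ'
  have hg1 : (1 : ℝ) ≤ g := by exact_mod_cast hg0
  set a : ℤ := (A' - 1) % Q' + 1 with ha
  obtain ⟨t, ht⟩ : ∃ t : ℤ, A' = a + Q' * t :=
    ⟨(A' - 1) / Q', by have := Int.emod_add_mul_ediv (A' - 1) Q'; rw [ha]; linarith⟩
  have hQz : (0 : ℤ) < Q' := by exact_mod_cast hQ'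
  refine ⟨hξ, a, B', Q', ⟨hQ', ?_, ?_, ?_, ?_, ?_⟩, ?_⟩
  · refine le_trans ?_ hQN
    push_cast
    nlinarith
  · refine le_trans ?_ hBN
    push_cast
    rw [abs_mul, Nat.abs_cast]
    nlinarith [abs_nonneg (B' : ℝ)]
  · have := Int.emod_nonneg (A' - 1) hQz.ne'
    omega
  · have := Int.emod_lt_of_pos (A' - 1) hQz
    omega
  · have hdvd : (Int.gcd a (Int.gcd B' (Q' : ℤ)) : ℤ) ∣ (Int.gcd A' (Int.gcd B' (Q' : ℤ)) : ℤ) := by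
      apply Int.dvd_coe_gcd
      · rw [ht]
        apply dvd_add (Int.gcd_dvd_left ..)
        exact ((Int.gcd_dvd_right ..).trans (Int.gcd_dvd_right ..)).mul_right t
      · exact Int.gcd_dvd_right ..
    rw [hcop] at hdvd
    exact Nat.dvd_one.1 (by exact_mod_cast hdvd)
  · refine le_trans (le_trans (round_le _ t) (le_of_eq ?_)) h
    congr 1
    have hg0' : (g : ℝ) ≠ 0 := by positivity
    rw [ht]
    push_cast
    field_simp
    ring

lemma mem_wideArcs_of_ne_zero {k N γ ξ : ℝ} (hξ : ξ ∈ Set.Ico (-(1 / 2) : ℝ) (1 / 2))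
    {A B Q : ℤ} (hQ : Q ≠ 0) (hQN : |(Q : ℝ)| ≤ N ^ γ) (hBN : |(B : ℝ)| ≤ N ^ γ)
    (h : |ξ - ((A : ℝ) + B * √k) / Q| ≤ N ^ (-1 + γ)) : ξ ∈ wideArcs k N γ := by
  rcases Int.eq_nat_or_neg Q with ⟨n, rfl | rfl⟩
  · refine mem_wideArcs_of_pos hξ (Q := n) (by omega) ?_ hBN (by exact_mod_cast h)
    simpa using hQN
  · refine mem_wideArcs_of_pos hξ (A := -A) (B := -B) (Q := n) (by omega) ?_ ?_ ?_
    · simpa using hQN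
    · simpa using hBN
    · convert h using 3
      push_cast
      rw [div_neg, ← neg_div]
      ring

/-- A near-resonance at a small shift forces `ξ` close to an element of `ℚ(√k)` of small height. -/
lemma exists_approximation {k : ℚ} (hk : 0 < k) (hirr : Irrational √(k : ℝ)) {ξ η : ℝ}
    (hξ : |ξ| ≤ 1 / 2) (hη : η ≤ 1) {R d : ℕ} (hd1 : 1 ≤ d) (hd : d < R) {e j m : ℤ}
    (he : e = 0 ∨ e = 1) (hj : |j| < (R ^ 5 : ℕ))
    (h : |ξ * ((⌊d * √(k : ℝ)⌋ : ℝ) + e + d * √(k : ℝ)) + j * √(k : ℝ) - m| < η) :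
    ∃ A B Q : ℤ, Q ≠ 0 ∧ |(Q : ℝ)| ≤ k.den * (4 * √(k : ℝ) + 3) * R ∧
      |(B : ℝ)| ≤ k.den * (4 * √(k : ℝ) + 3) * R ^ 6 ∧
      |ξ - ((A : ℝ) + B * √(k : ℝ)) / Q| ≤ η / √(k : ℝ) := by
  set α := √(k : ℝ) with hαdef
  have hk' : (0 : ℝ) < k := by exact_mod_cast hk
  have hα0 : 0 < α := Real.sqrt_pos.2 hk'
  have hsq : α ^ 2 = k := Real.sq_sqrt hk'.le
  have hr : (0 : ℝ) < k.den := by exact_mod_cast k.den_pos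
  have hkd : (k : ℝ) * k.den = k.num := by exact_mod_cast Rat.mul_den_eq_num k
  have hd1' : (1 : ℝ) ≤ d := by exact_mod_cast hd1
  have hdR : (d : ℝ) ≤ R := by exact_mod_cast hd.le
  have hR1 : (1 : ℝ) ≤ R := hd1'.trans hdR
  have hR5 : (R : ℝ) ≤ R ^ 5 := le_self_pow₀ hR1 (by norm_num)
  have hj' : |(j : ℝ)| ≤ R ^ 5 := by exact_mod_cast hj.le
  obtain ⟨l, hl⟩ : ∃ l : ℤ, l = ⌊d * α⌋ + e := ⟨_, rfl⟩
  have hl' : (⌊d * α⌋ : ℝ) + e = l := by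
    rw [hl]
    push_cast
    ring
  rw [hl'] at h
  have he' : (0 : ℝ) ≤ e ∧ (e : ℝ) ≤ 1 := by
    rcases he with rfl | rfl <;> norm_num
  have hfl := Int.floor_le (d * α)
  have hfl2 := Int.lt_floor_add_one (d * α)
  have hdiff : |(l : ℝ) - d * α| ≤ 1 := by
    rw [abs_le, ← hl']
    constructor <;> linarith
  have hl0 : (0 : ℝ) ≤ l := by
    have : (0 : ℝ) ≤ ⌊d * α⌋ := by
      exact_mod_cast Int.floor_nonneg.2 (by positivity)
    linarith
  have hlR : (l : ℝ) ≤ (α + 1) * R := by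
    rw [abs_le] at hdiff
    nlinarith
  have hDlow : α ≤ (l : ℝ) + d * α := by nlinarith
  have hDup : (l : ℝ) + d * α ≤ (2 * α + 1) * R := by nlinarith
  have hD0 : 0 < (l : ℝ) + d * α := by linarith
  have hm : |(m : ℝ)| ≤ (3 * α + 2) * R ^ 5 := by
    have e1 : (m : ℝ) = ξ * (l + d * α) + j * α - (ξ * (l + d * α) + j * α - m) := by ring
    have e2 : |(m : ℝ)| ≤ |ξ| * (l + d * α) + |(j : ℝ)| * α + η := by
      rw [e1]
      refine (abs_sub _ _).trans (add_le_add ((abs_add_le _ _).trans ?_) h.le)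
      rw [abs_mul, abs_mul, abs_of_pos hD0, abs_of_pos hα0]
    have e3 : |ξ| * (l + d * α) ≤ (2 * α + 1) * R ^ 5 := by
      nlinarith [abs_nonneg ξ]
    nlinarith
  have hQeq : ((k.den * l ^ 2 - k.num * d ^ 2 : ℤ) : ℝ) =
      k.den * ((l - d * α) * (l + d * α)) := by
    push_cast
    rw [← hkd, ← hsq]
    ring
  have hldne : (l : ℝ) - d * α ≠ 0 := by
    have hir : Irrational ((d : ℝ) * α) := hirr.natCast_mul (by omega)
    intro h0
    exact hir.ne_int l (by linarith)
  have hQne : ((k.den * l ^ 2 - k.num * d ^ 2 : ℤ) : ℝ) ≠ 0 := by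
    rw [hQeq]
    exact mul_ne_zero hr.ne' (mul_ne_zero hldne hD0.ne')
  refine ⟨k.den * m * l + k.num * j * d, -(k.den * (m * d + j * l)),
    k.den * l ^ 2 - k.num * d ^ 2, by exact_mod_cast hQne, ?_, ?_, ?_⟩
  · rw [hQeq, abs_mul, abs_mul, abs_of_pos hr, abs_of_pos hD0, mul_assoc]
    refine mul_le_mul_of_nonneg_left ?_ hr.le
    calc |(l : ℝ) - d * α| * (l + d * α) ≤ 1 * ((2 * α + 1) * R) := by gcongr
      _ ≤ (4 * α + 3) * R := by nlinarith
  · push_cast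
    rw [abs_neg, abs_mul, abs_of_pos hr, mul_assoc]
    refine mul_le_mul_of_nonneg_left ?_ hr.le
    calc |(m : ℝ) * d + j * l| ≤ |(m : ℝ)| * d + |(j : ℝ)| * l := by
          refine (abs_add_le _ _).trans ?_
          rw [abs_mul, abs_mul, Nat.abs_cast, abs_of_nonneg hl0]
      _ ≤ (3 * α + 2) * R ^ 5 * R + R ^ 5 * ((α + 1) * R) := by gcongr
      _ = _ := by ring
  · have e1 : ξ - (((k.den * m * l + k.num * j * d : ℤ) : ℝ) +
        ((-(k.den * (m * d + j * l)) : ℤ) : ℝ) * α) /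
        ((k.den * l ^ 2 - k.num * d ^ 2 : ℤ) : ℝ) =
        (ξ * (l + d * α) + j * α - m) / (l + d * α) := by
      rw [eq_div_iff hD0.ne', sub_mul, div_mul_eq_mul_div, sub_eq_iff_eq_add, ← sub_eq_iff_eq_add',
        eq_div_iff hQne, hQeq]
      push_cast
      rw [← hkd, ← hsq]
      ring
    rw [e1, abs_div, abs_of_pos hD0]
    have hη0 : 0 ≤ η := (abs_nonneg _).trans h.le
    gcongr

lemma norm_expSum_le_one {k N ξ : ℝ} (hN : 1 ≤ N) : ‖expSum k N ξ‖ ≤ 1 := by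
  have hN0 : 0 < N := by linarith
  unfold expSum
  rw [norm_mul, norm_inv, Complex.norm_real, Real.norm_of_nonneg hN0.le, inv_mul_le_iff₀ hN0,
    mul_one]
  calc _ ≤ ∑ n ∈ Finset.Icc 1 (⌊N⌋).toNat, (1 : ℝ) :=
        norm_sum_le_of_le _ fun n _ => (norm_expc _).le
    _ = (⌊N⌋₊ : ℝ) := by simp [Int.floor_toNat]
    _ ≤ N := Nat.floor_le hN0.le

/-- Cancellation off the wide arcs, in terms of `T = N ^ (γ / 7)`. -/
lemma norm_expSum_le_of_notMem_wideArcs {k : ℚ} (hk : 0 < k) (hirr : Irrational √(k : ℝ)) {c : ℝ}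
    (hc : 0 < c) (hα : ∀ h : ℕ, 0 < h → ∀ m : ℤ, c ≤ h * |h * √(k : ℝ) - m|)
    {N γ T ξ : ℝ} (hN : 1 ≤ N) (hTγ : T ^ 7 = N ^ γ) (hTN : T ^ 7 ≤ N) (hT2 : 2 ≤ T)
    (hTk : k.den * (4 * √(k : ℝ) + 3) ≤ T) (hTα : 2 / √(k : ℝ) ≤ T)
    (hξ : ξ ∈ Set.Ico (-(1 / 2) : ℝ) (1 / 2)) (hwide : ξ ∉ wideArcs k N γ) :
    ‖expSum k N ξ‖ ≤ 2 * (√(37 + 32 / c) + 2) / √T := by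
  have hN0 : 0 < N := by linarith
  have hα0 : 0 < √(k : ℝ) := Real.sqrt_pos.2 (by exact_mod_cast hk)
  have hT0 : 0 < T := by linarith
  obtain ⟨R, hRdef⟩ : ∃ R : ℕ, R = ⌊T⌋₊ := ⟨_, rfl⟩
  obtain ⟨M, hMdef⟩ : ∃ M : ℕ, M = ⌊N⌋₊ := ⟨_, rfl⟩
  have hRT : (R : ℝ) ≤ T := hRdef ▸ Nat.floor_le hT0.le
  have hRT2 : T < R + 1 := hRdef ▸ Nat.lt_floor_add_one T
  have hR1 : 1 ≤ R := hRdef ▸ Nat.le_floor (by push_cast; linarith)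
  have hR1' : (1 : ℝ) ≤ R := by exact_mod_cast hR1
  have hMN : (M : ℝ) ≤ N := hMdef ▸ Nat.floor_le hN0.le
  have hMN2 : N < M + 1 := hMdef ▸ Nat.lt_floor_add_one N
  have hM1 : 1 ≤ M := hMdef ▸ Nat.le_floor (by simpa using hN)
  have hM1' : (1 : ℝ) ≤ M := by exact_mod_cast hM1
  have hRT6 : (R : ℝ) ^ 6 ≤ T ^ 6 := by gcongr
  have hT67 : 2 * T ^ 6 ≤ T ^ 7 := by
    rw [pow_succ T 6]
    nlinarith [pow_pos hT0 6]
  have hR6M : (R : ℝ) ^ 6 ≤ M := by linarith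
  have hR2M : R ^ 2 ≤ M := by
    have : R ^ 6 ≤ M := by exact_mod_cast hR6M
    exact (Nat.pow_le_pow_right hR1 (by norm_num)).trans this
  have hξ2 : |ξ| ≤ 1 / 2 := by
    rw [abs_le]
    exact ⟨hξ.1, hξ.2.le⟩
  have hsum := norm_sum_Icc_expc_le hc hα hξ2 hR1 hR2M (by
    intro d hd1 hd e he j hj m
    by_contra hlt
    rw [not_le] at hlt
    apply hwide
    obtain ⟨A, B, Q, hQ, hQb, hBb, hclose⟩ := exists_approximation hk hirr hξ2
      (by rw [div_le_one (by positivity)]; exact hR6M) hd1 hd he hj hlt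
    refine mem_wideArcs_of_ne_zero hξ hQ (hQb.trans ?_) (hBb.trans ?_) (hclose.trans ?_)
    · rw [← hTγ]
      calc _ ≤ T * T := by gcongr
        _ = T ^ 2 := by ring
        _ ≤ T ^ 7 := pow_le_pow_right₀ (by linarith) (by norm_num)
    · rw [← hTγ]
      calc _ ≤ T * T ^ 6 := by gcongr
        _ = T ^ 7 := by ring
    · rw [Real.rpow_add hN0, Real.rpow_neg_one, ← hTγ]
      have hM2 : N / 2 ≤ M := by linarith
      calc (R : ℝ) ^ 6 / M / √(k : ℝ) ≤ T ^ 6 / (N / 2) / √(k : ℝ) := by gcongr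
        _ = N⁻¹ * T ^ 6 * (2 / √(k : ℝ)) := by field_simp
        _ ≤ N⁻¹ * T ^ 6 * T := by gcongr
        _ = _ := by ring)
  unfold expSum
  rw [norm_mul, norm_inv, Complex.norm_real, Real.norm_of_nonneg hN0.le, inv_mul_le_iff₀ hN0,
    Int.floor_toNat, ← hMdef]
  refine hsum.trans ?_
  have hsT : √T ≤ 2 * √R := by
    rw [Real.sqrt_le_left (by positivity), mul_pow, Real.sq_sqrt (by positivity)]
    linarith
  have hsT0 : 0 < √T := Real.sqrt_pos.2 hT0
  have hsR0 : 0 < √(R : ℝ) := Real.sqrt_pos.2 (by linarith)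
  rw [← mul_div_assoc, div_le_div_iff₀ hsR0 hsT0]
  calc _ ≤ (√(37 + 32 / c) + 2) * N * (2 * √R) := by gcongr
    _ = _ := by ring

/-- **Estimate for `m₁`** (Lemma: minor arcs, part 1).
Let `k` be a positive rational with `√k` irrational and `γ, γ' ∈ (0, 1/10)`.  Then there exist
constants `χ = χ(γ) > 0` and `C = C(k, γ, γ') > 0` such that for every `N ≥ 1` and every
`ξ ∈ m₁(N; k, γ, γ')`, `|(1/N) ∑_{n=1}^{⌊N⌋} e(ξ n⌊n√k⌋)| ≤ C N^{−χ}`. -/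
theorem minor_arc_estimate_m1 :
    ∀ (γ : ℝ), γ ∈ Set.Ioo (0 : ℝ) (1 / 10) →
      ∃ χ > (0 : ℝ), ∀ (γ' : ℝ), γ' ∈ Set.Ioo (0 : ℝ) (1 / 10) →
        ∀ (k : ℚ), 0 < k → Irrational (Real.sqrt (k : ℝ)) →
          ∃ C > (0 : ℝ), ∀ (N : ℝ), 1 ≤ N →
            ∀ ξ ∈ minor1 (k : ℝ) N γ γ',
              ‖expSum (k : ℝ) N ξ‖ ≤ C * N ^ (-χ) := by
  intro γ hγ
  refine ⟨γ / 14, by linarith [hγ.1], fun γ' _ k hk hirr => ?_⟩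
  obtain ⟨c, hc, hα⟩ := exists_badly_approximable hk hirr
  set L : ℝ := max 2 (max (k.den * (4 * √(k : ℝ) + 3)) (2 / √(k : ℝ))) with hL
  have hL2 : 2 ≤ L := le_max_left _ _
  refine ⟨2 * (√(37 + 32 / c) + 2) + √L, by positivity, fun N hN ξ hξ => ?_⟩
  have hN0 : 0 < N := by linarith
  have hT0 : 0 < N ^ (γ / 7) := by positivity
  have hdecay : N ^ (-(γ / 14)) = 1 / √(N ^ (γ / 7)) := by
    rw [Real.sqrt_eq_rpow, ← Real.rpow_mul hN0.le, Real.rpow_neg hN0.le, one_div]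
    congr 2
    ring
  have hTγ : (N ^ (γ / 7)) ^ 7 = N ^ γ := by
    rw [← Real.rpow_natCast, ← Real.rpow_mul hN0.le]
    congr 1
    push_cast
    ring
  have hTN : (N ^ (γ / 7)) ^ 7 ≤ N := by
    rw [hTγ]
    calc N ^ γ ≤ N ^ (1 : ℝ) := Real.rpow_le_rpow_of_exponent_le hN (by linarith [hγ.2])
      _ = N := Real.rpow_one N
  rw [hdecay, mul_one_div]
  have hs0 : 0 < √(N ^ (γ / 7)) := Real.sqrt_pos.2 hT0
  rcases le_or_gt L (N ^ (γ / 7)) with hbig | hsmall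
  · have hwide : ξ ∉ wideArcs k N γ := fun hw => hξ.2 ⟨hw, hξ.1.2⟩
    refine (norm_expSum_le_of_notMem_wideArcs hk hirr hc hα hN hTγ hTN (hL2.trans hbig)
      (((le_max_left _ _).trans (le_max_right _ _)).trans hbig)
      (((le_max_right _ _).trans (le_max_right _ _)).trans hbig) hξ.1.1 hwide).trans ?_
    gcongr
    linarith [Real.sqrt_nonneg L]
  · refine (norm_expSum_le_one hN).trans ?_
    rw [le_div_iff₀ hs0, one_mul]
    have h1 : √(N ^ (γ / 7)) ≤ √L := Real.sqrt_le_sqrt hsmall.le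
    have h2 : 0 ≤ 2 * (√(37 + 32 / c) + 2) := by positivity
    linarith
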